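/- arXiv:0901.0876 — 8 statements merged into one kernel-verified Lean document; each statement's English description precedes it below -/
import Mathlib

section
/- Exact fit property of PTS: assume every p of the rows x_1,…,x_n are linearly independent, and suppose there exists β ∈ ℝ^p such that the exact-fit set H = {i : ⟨x_i, β⟩ = y_i} has cardinality m with 2m > n + p − 1, while no p + 1 of the points (x_i, y_i) lie on a common hyperplane {(x,y) : y = ⟨x, γ⟩} other than the one given by β. Then there exists ε₀ > 0 such that for every ε with 0 < ε < ε₀, taking all penalties equal to ε, every subset T* minimizing the PTS loss L equals H, and the corresponding least squares estimate on T* equals β. -/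
theorem pts_gap {n p : ℕ} (X : Matrix (Fin n) (Fin p) ℝ) (y : Fin n → ℝ) (T : Finset (Fin n)) :
    ∃ c > (0:ℝ), (∃ γ : Fin p → ℝ, ∀ i ∈ T, ∑ j, X i j * γ j = y i) ∨
      ∀ b : Fin p → ℝ, c ≤ ∑ i ∈ T, (y i - ∑ j, X i j * b j) ^ 2 := by
  classical
  let A : (Fin p → ℝ) →ₗ[ℝ] (T → ℝ) :=
    (Matrix.of (fun (i : T) j => X i.1 j)).mulVecLin
  have hA : ∀ b i, A b i = ∑ j, X i.1 j * b j := fun b i => rfl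
  let yT : T → ℝ := fun i => y i.1
  by_cases h : yT ∈ LinearMap.range A
  · obtain ⟨γ, hγ⟩ := h
    refine ⟨1, one_pos, Or.inl ⟨γ, fun i hi => ?_⟩⟩
    have := congrFun hγ ⟨i, hi⟩
    rw [hA] at this
    exact this
  · have hc : IsClosed (LinearMap.range A : Set (T → ℝ)) :=
      Submodule.closed_of_finiteDimensional _
    obtain ⟨δ, hδ, hb⟩ := Metric.isOpen_iff.1 hc.isOpen_compl yT h
    refine ⟨δ ^ 2, by positivity, Or.inr fun b => ?_⟩
    by_contra! hlt
    have : A b ∈ Metric.ball yT δ := by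
      rw [Metric.mem_ball, dist_pi_lt_iff hδ]
      intro i
      rw [dist_comm, Real.dist_eq, hA]
      have h1 : (y i.1 - ∑ j, X i.1 j * b j) ^ 2 ≤ ∑ i ∈ T, (y i - ∑ j, X i j * b j) ^ 2 :=
        Finset.single_le_sum (f := fun i => (y i - ∑ j, X i j * b j) ^ 2)
          (fun i _ => sq_nonneg _) i.2
      exact abs_lt_of_sq_lt_sq (h1.trans_lt hlt) hδ.le
    exact hb this ⟨b, rfl⟩

/-- Exact fit property of PTS. Assume every `p` of the rows of `X`
are linearly independent, and suppose `β` fits exactly a set `H` of observations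
with `2|H| > n + p − 1`, while no `p + 1` of the points lie on a common
hyperplane other than the one given by `β`. Then there exists `ε₀ > 0` such that
for all penalties equal to `ε` with `0 < ε < ε₀`, every subset `Tstar` minimizing
the PTS loss equals `H`, and the least squares estimate on `Tstar` equals `β`. -/
theorem pts_exact_fit_property
    (n p : ℕ) (hp : 1 ≤ p) (hpn : p ≤ n)
    (X : Matrix (Fin n) (Fin p) ℝ) (y : Fin n → ℝ)
    (hgp : ∀ S : Finset (Fin n), S.card = p →
      LinearIndependent ℝ (fun i : S => X i.1))
    (β : Fin p → ℝ) (H : Finset (Fin n))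
    (hH : ∀ i, i ∈ H ↔ ∑ j, X i j * β j = y i)
    (hHcard : n + p - 1 < 2 * H.card)
    (hunique : ∀ γ : Fin p → ℝ, γ ≠ β → ∀ S : Finset (Fin n),
      (∀ i ∈ S, ∑ j, X i j * γ j = y i) → S.card ≤ p) :
    ∃ ε₀ > (0 : ℝ), ∀ ε : ℝ, 0 < ε → ε < ε₀ →
      ∀ Tstar : Finset (Fin n),
        (∀ T : Finset (Fin n),
          sInf (Set.range fun b : Fin p → ℝ =>
              ∑ i ∈ Tstar, (y i - ∑ j, X i j * b j) ^ 2) + ∑ _i ∈ Tstarᶜ, ε ≤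
          sInf (Set.range fun b : Fin p → ℝ =>
              ∑ i ∈ T, (y i - ∑ j, X i j * b j) ^ 2) + ∑ _i ∈ Tᶜ, ε) →
        Tstar = H ∧
        ∀ βT : Fin p → ℝ,
          (∀ β' : Fin p → ℝ,
            ∑ i ∈ Tstar, (y i - ∑ j, X i j * βT j) ^ 2 ≤
            ∑ i ∈ Tstar, (y i - ∑ j, X i j * β' j) ^ 2) →
          βT = β := by
  classical
  choose c hc hgap using pts_gap X y
  obtain ⟨T0, -, hT0⟩ := Finset.exists_min_image (Finset.univ : Finset (Finset (Fin n))) c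
    ⟨∅, Finset.mem_univ _⟩
  have hn : (0:ℝ) < n := by exact_mod_cast (by omega : 0 < n)
  have hHn : H.card ≤ n := by simpa using H.card_le_univ
  have hbdd : ∀ T : Finset (Fin n), BddBelow (Set.range fun b : Fin p → ℝ =>
      ∑ i ∈ T, (y i - ∑ j, X i j * b j) ^ 2) := fun T =>
    ⟨0, by rintro _ ⟨b, rfl⟩; exact Finset.sum_nonneg fun i _ => sq_nonneg _⟩
  have hzero : ∑ i ∈ H, (y i - ∑ j, X i j * β j) ^ 2 = 0 :=
    Finset.sum_eq_zero fun i hi => by rw [(hH i).1 hi]; simp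
  refine ⟨c T0 / n, div_pos (hc _) hn, fun ε hε hε0 Ts hTs => ?_⟩
  have hcompl : ∀ T : Finset (Fin n), ∑ _i ∈ Tᶜ, ε = (n - T.card : ℝ) * ε := by
    intro T
    have : T.card ≤ n := by simpa using T.card_le_univ
    simp [Finset.card_compl, Nat.cast_sub this]
  have hmin := hTs H
  rw [hcompl, hcompl] at hmin
  have hHinf : sInf (Set.range fun b : Fin p → ℝ =>
      ∑ i ∈ H, (y i - ∑ j, X i j * b j) ^ 2) ≤ 0 :=
    (csInf_le (hbdd H) ⟨β, rfl⟩).trans hzero.le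
  have hTn : (Ts.card : ℝ) ≤ n := by exact_mod_cast (by simpa using Ts.card_le_univ : Ts.card ≤ n)
  have hTinf : 0 ≤ sInf (Set.range fun b : Fin p → ℝ =>
      ∑ i ∈ Ts, (y i - ∑ j, X i j * b j) ^ 2) :=
    Real.sInf_nonneg (by rintro _ ⟨b, rfl⟩; exact Finset.sum_nonneg fun i _ => sq_nonneg _)
  have hcard : H.card ≤ Ts.card := by
    have : (H.card : ℝ) * ε ≤ Ts.card * ε := by linarith
    exact_mod_cast le_of_mul_le_mul_right this hε
  have hfit : ∃ γ : Fin p → ℝ, ∀ i ∈ Ts, ∑ j, X i j * γ j = y i := by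
    rcases hgap Ts with h | h
    · exact h
    · exfalso
      have h1 : c Ts ≤ sInf (Set.range fun b : Fin p → ℝ =>
          ∑ i ∈ Ts, (y i - ∑ j, X i j * b j) ^ 2) :=
        le_csInf (Set.range_nonempty _) (by rintro _ ⟨b, rfl⟩; exact h b)
      have h2 := hT0 Ts (Finset.mem_univ _)
      rw [lt_div_iff₀ hn] at hε0
      have h3 : 0 ≤ (n - Ts.card : ℝ) * ε := mul_nonneg (by linarith) hε.le
      have h4 : 0 ≤ (H.card : ℝ) * ε := by positivity
      linarith
  obtain ⟨γ, hγ⟩ := hfit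
  have hEq : Ts = H := by
    by_cases hg : γ = β
    · subst hg
      exact Finset.eq_of_subset_of_card_le (fun i hi => (hH i).2 (hγ i hi)) hcard
    · have := hunique γ hg Ts hγ
      have e1 : Ts = Finset.univ := Finset.eq_univ_of_card _ (by simp; omega)
      have e2 : H = Finset.univ := Finset.eq_univ_of_card _ (by simp; omega)
      rw [e1, e2]
  refine ⟨hEq, fun b hb => ?_⟩
  subst hEq
  have hb0 : ∑ i ∈ Ts, (y i - ∑ j, X i j * b j) ^ 2 = 0 :=
    le_antisymm ((hb β).trans hzero.le) (Finset.sum_nonneg fun i _ => sq_nonneg _)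
  rw [Finset.sum_eq_zero_iff_of_nonneg fun i _ => sq_nonneg _] at hb0
  obtain ⟨S, hST, hS⟩ := Finset.exists_subset_card_eq (show p ≤ Ts.card by omega)
  have hli := hgp S hS
  let e : Fin p ≃ S := (S.equivFinOfCardEq hS).symm
  have hli' : LinearIndependent ℝ (Matrix.of fun i : Fin p => X (e i).1).row :=
    hli.comp e e.injective
  have hu := Matrix.linearIndependent_rows_iff_isUnit.1 hli'
  apply Matrix.mulVec_injective_of_isUnit hu
  funext i
  have hi := hST (e i).2
  have h1 := (hH _).1 hi
  have h2 := pow_eq_zero_iff (two_ne_zero) |>.1 (hb0 _ hi)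
  change ∑ j, X (e i).1 j * b j = ∑ j, X (e i).1 j * β j
  linarith
end

section
/- High breakdown from the exact fit property: let n > p ≥ 1 and let T be any map assigning to each dataset (X', y') ∈ ℝ^{n×p} × ℝⁿ an estimate T(X', y') ∈ ℝ^p which satisfies the exact fit property: whenever the rows of X' are in general position (every p of them are linearly independent) and strictly more than (n + p − 1)/2 indices i satisfy ⟨x'_i, β⟩ = y'_i for some β ∈ ℝ^p, then T(X', y') = β. Let (X, y) be a dataset with y = Xβ₀ whose rows are in general position. Then for every integer m with 2m < n − p + 1 and every dataset (X'', y'') that differs from (X, y) in at most m observations and whose rows are in general position, T(X'', y'') = β₀; in particular, the finite-sample replacement breakdown point of T at (X, y) is at least (n − p − 1)/(2n). -/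
/-- High breakdown from the exact fit property. Let `T` be any
estimator satisfying the exact fit property: whenever the rows of a dataset are
in general position and strictly more than `(n + p − 1)/2` observations are fit
exactly by some `β`, the estimate equals `β`. If `y = X β₀` and the rows of `X`
are in general position, then for every `m` with `2m < n − p + 1` and every
dataset `(X'', y'')` in general position differing from `(X, y)` in at most `m`
observations, the estimate on `(X'', y'')` equals `β₀`. -/
theorem exact_fit_implies_high_breakdown
    (n p : ℕ) (hp : 1 ≤ p) (hpn : p < n)
    (T : Matrix (Fin n) (Fin p) ℝ → (Fin n → ℝ) → (Fin p → ℝ))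
    (hexact : ∀ (X' : Matrix (Fin n) (Fin p) ℝ) (y' : Fin n → ℝ) (β : Fin p → ℝ),
      (∀ S : Finset (Fin n), S.card = p →
        LinearIndependent ℝ (fun i : S => X' i.1)) →
      (∀ H : Finset (Fin n), (∀ i, i ∈ H ↔ ∑ j, X' i j * β j = y' i) →
        n + p - 1 < 2 * H.card) →
      T X' y' = β)
    (X : Matrix (Fin n) (Fin p) ℝ) (y : Fin n → ℝ) (β₀ : Fin p → ℝ)
    (hy : ∀ i, y i = ∑ j, X i j * β₀ j)
    (hgp : ∀ S : Finset (Fin n), S.card = p →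
      LinearIndependent ℝ (fun i : S => X i.1)) :
    ∀ m : ℕ, 2 * m < n - p + 1 →
      ∀ (X'' : Matrix (Fin n) (Fin p) ℝ) (y'' : Fin n → ℝ),
        (∀ S : Finset (Fin n), S.card = p →
          LinearIndependent ℝ (fun i : S => X'' i.1)) →
        (∃ D : Finset (Fin n), D.card ≤ m ∧
          ∀ i, i ∉ D → X'' i = X i ∧ y'' i = y i) →
        T X'' y'' = β₀ := by
  intro m hm X'' y'' hgp'' ⟨D, hD, hDe⟩
  refine hexact X'' y'' β₀ hgp'' ?_
  intro H hH
  have hsub : Dᶜ ⊆ H := by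
    intro i hi
    obtain ⟨h1, h2⟩ := hDe i (Finset.mem_compl.mp hi)
    rw [hH, h1, h2, hy]
  have hc := Finset.card_le_card hsub
  rw [Finset.card_compl, Fintype.card_fin] at hc
  omega
end

section
/- Necessary optimality condition (retained observations): if T ⊆ {1,…,n} minimizes the PTS loss L over all subsets of {1,…,n}, and β_T minimizes β ↦ Σ_{i∈T} (y_i − ⟨x_i,β⟩)², then (y_i − ⟨x_i,β_T⟩)² ≤ p_i for every i ∈ T. -/
/-- Necessary optimality condition (retained observations): if `T`
minimizes the PTS loss `L` over all subsets and `βT` minimizes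
`β ↦ ∑_{i∈T} (y i − ⟨x i, β⟩)²`, then `(y i − ⟨x i, βT⟩)² ≤ p i` for all `i ∈ T`. -/
theorem pts_necessary_condition_retained
    (n p : ℕ) (hp : 1 ≤ p) (hpn : p ≤ n)
    (X : Matrix (Fin n) (Fin p) ℝ) (y : Fin n → ℝ)
    (pen : Fin n → ℝ) (hpen : ∀ i, 0 < pen i)
    (T : Finset (Fin n))
    (hTmin : ∀ T' : Finset (Fin n),
      sInf (Set.range fun b : Fin p → ℝ =>
          ∑ i ∈ T, (y i - ∑ j, X i j * b j) ^ 2) + ∑ i ∈ Tᶜ, pen i ≤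
      sInf (Set.range fun b : Fin p → ℝ =>
          ∑ i ∈ T', (y i - ∑ j, X i j * b j) ^ 2) + ∑ i ∈ T'ᶜ, pen i)
    (βT : Fin p → ℝ)
    (hβT : ∀ β : Fin p → ℝ,
      ∑ i ∈ T, (y i - ∑ j, X i j * βT j) ^ 2 ≤
      ∑ i ∈ T, (y i - ∑ j, X i j * β j) ^ 2) :
    ∀ i ∈ T, (y i - ∑ j, X i j * βT j) ^ 2 ≤ pen i := by
  intro i hi
  have h := hTmin (T.erase i)
  have h1 : ∑ i ∈ T, (y i - ∑ j, X i j * βT j) ^ 2 ≤ sInf (Set.range fun b : Fin p → ℝ =>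
      ∑ i ∈ T, (y i - ∑ j, X i j * b j) ^ 2) := by
    apply le_csInf (Set.range_nonempty _)
    rintro _ ⟨b, rfl⟩
    exact hβT b
  have h2 : sInf (Set.range fun b : Fin p → ℝ =>
      ∑ k ∈ T.erase i, (y k - ∑ j, X k j * b j) ^ 2) ≤
      ∑ k ∈ T.erase i, (y k - ∑ j, X k j * βT j) ^ 2 := by
    refine csInf_le ⟨0, ?_⟩ ⟨βT, rfl⟩
    rintro _ ⟨b, rfl⟩
    exact Finset.sum_nonneg fun k _ => sq_nonneg _
  have h3 := Finset.add_sum_erase T (fun k => (y k - ∑ j, X k j * βT j) ^ 2) hi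
  have h4 := Finset.add_sum_erase T pen hi
  have h5 := Finset.sum_add_sum_compl T pen
  have h6 := Finset.sum_add_sum_compl (T.erase i) pen
  linarith
end

section
/- Necessary optimality condition (deleted observations): if T ⊆ {1,…,n} minimizes the PTS loss L over all subsets of {1,…,n}, and β_T minimizes β ↦ Σ_{i∈T} (y_i − ⟨x_i,β⟩)², then (y_i − ⟨x_i,β_T⟩)² ≥ p_i for every i ∉ T. -/
/-- Necessary optimality condition (deleted observations): if `T`
minimizes the PTS loss `L` over all subsets and `βT` minimizes
`β ↦ ∑_{i∈T} (y i − ⟨x i, β⟩)²`, then `(y i − ⟨x i, βT⟩)² ≥ p i` for all `i ∉ T`. -/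
theorem pts_necessary_condition_deleted
    (n p : ℕ) (hp : 1 ≤ p) (hpn : p ≤ n)
    (X : Matrix (Fin n) (Fin p) ℝ) (y : Fin n → ℝ)
    (pen : Fin n → ℝ) (hpen : ∀ i, 0 < pen i)
    (T : Finset (Fin n))
    (hTmin : ∀ T' : Finset (Fin n),
      sInf (Set.range fun b : Fin p → ℝ =>
          ∑ i ∈ T, (y i - ∑ j, X i j * b j) ^ 2) + ∑ i ∈ Tᶜ, pen i ≤
      sInf (Set.range fun b : Fin p → ℝ =>
          ∑ i ∈ T', (y i - ∑ j, X i j * b j) ^ 2) + ∑ i ∈ T'ᶜ, pen i)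
    (βT : Fin p → ℝ)
    (hβT : ∀ β : Fin p → ℝ,
      ∑ i ∈ T, (y i - ∑ j, X i j * βT j) ^ 2 ≤
      ∑ i ∈ T, (y i - ∑ j, X i j * β j) ^ 2) :
    ∀ i, i ∉ T → pen i ≤ (y i - ∑ j, X i j * βT j) ^ 2 := by
  intro k hk
  have h := hTmin (insert k T)
  have h1 : ∑ i ∈ T, (y i - ∑ j, X i j * βT j) ^ 2 ≤
      sInf (Set.range fun b : Fin p → ℝ => ∑ i ∈ T, (y i - ∑ j, X i j * b j) ^ 2) := by
    apply le_csInf (Set.range_nonempty _)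
    rintro _ ⟨b, rfl⟩
    exact hβT b
  have h2 : sInf (Set.range fun b : Fin p → ℝ =>
      ∑ i ∈ insert k T, (y i - ∑ j, X i j * b j) ^ 2) ≤
      ∑ i ∈ insert k T, (y i - ∑ j, X i j * βT j) ^ 2 := by
    apply csInf_le
    · refine ⟨0, ?_⟩
      rintro _ ⟨b, rfl⟩
      exact Finset.sum_nonneg fun i _ => sq_nonneg _
    · exact ⟨βT, rfl⟩
  rw [Finset.sum_insert hk] at h2
  have h3 := Finset.sum_add_sum_compl T pen
  have h4 := Finset.sum_add_sum_compl (insert k T) pen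
  rw [Finset.sum_insert hk] at h4
  linarith
end

section
/- Strict improvement by deleting penalty-violating observations: let T ⊆ {1,…,n}, let β_T minimize β ↦ Σ_{i∈T} (y_i − ⟨x_i,β⟩)², and suppose the set S₁ = {i ∈ T : (y_i − ⟨x_i,β_T⟩)² > p_i} is nonempty. Then L(T \ S₁) < L(T). -/
open scoped Classical

/-- Strict improvement by deleting penalty-violating observations:
if `βT` minimizes `β ↦ ∑_{i∈T} (y i − ⟨x i, β⟩)²` and the set
`S₁ = {i ∈ T : (y i − ⟨x i, βT⟩)² > p i}` is nonempty, then `L(T \ S₁) < L(T)`. -/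
theorem pts_strict_improvement_delete
    (n p : ℕ) (hp : 1 ≤ p) (hpn : p ≤ n)
    (X : Matrix (Fin n) (Fin p) ℝ) (y : Fin n → ℝ)
    (pen : Fin n → ℝ) (hpen : ∀ i, 0 < pen i)
    (T : Finset (Fin n)) (βT : Fin p → ℝ)
    (hβT : ∀ β : Fin p → ℝ,
      ∑ i ∈ T, (y i - ∑ j, X i j * βT j) ^ 2 ≤
      ∑ i ∈ T, (y i - ∑ j, X i j * β j) ^ 2)
    (S₁ : Finset (Fin n))
    (hS₁ : S₁ = T.filter (fun i => pen i < (y i - ∑ j, X i j * βT j) ^ 2))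
    (hS₁ne : S₁.Nonempty) :
    sInf (Set.range fun b : Fin p → ℝ =>
        ∑ i ∈ T \ S₁, (y i - ∑ j, X i j * b j) ^ 2) + ∑ i ∈ (T \ S₁)ᶜ, pen i <
    sInf (Set.range fun b : Fin p → ℝ =>
        ∑ i ∈ T, (y i - ∑ j, X i j * b j) ^ 2) + ∑ i ∈ Tᶜ, pen i := by
  have hsub : S₁ ⊆ T := by rw [hS₁]; exact Finset.filter_subset _ _
  have h1 : sInf (Set.range fun b : Fin p → ℝ =>
        ∑ i ∈ T \ S₁, (y i - ∑ j, X i j * b j) ^ 2) ≤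
        ∑ i ∈ T \ S₁, (y i - ∑ j, X i j * βT j) ^ 2 := by
    apply csInf_le
    · refine ⟨0, ?_⟩
      rintro _ ⟨b, rfl⟩
      exact Finset.sum_nonneg fun i _ => sq_nonneg _
    · exact ⟨βT, rfl⟩
  have h2 : ∑ i ∈ T, (y i - ∑ j, X i j * βT j) ^ 2 ≤ sInf (Set.range fun b : Fin p → ℝ =>
        ∑ i ∈ T, (y i - ∑ j, X i j * b j) ^ 2) := by
    apply le_csInf (Set.range_nonempty _)
    rintro _ ⟨b, rfl⟩
    exact hβT b
  have h3 : ∑ i ∈ S₁, pen i < ∑ i ∈ S₁, (y i - ∑ j, X i j * βT j) ^ 2 := by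
    apply Finset.sum_lt_sum_of_nonempty hS₁ne
    intro i hi
    rw [hS₁] at hi
    exact (Finset.mem_filter.mp hi).2
  have h4 := Finset.sum_sdiff (f := fun i => (y i - ∑ j, X i j * βT j) ^ 2) hsub
  have h5 := Finset.sum_sdiff (f := pen) hsub
  have h6 := Finset.sum_add_sum_compl T pen
  have h7 := Finset.sum_add_sum_compl (T \ S₁) pen
  linarith
end

section
/- Strict improvement by adding small-residual observations: let T ⊆ {1,…,n}, let β_T minimize β ↦ Σ_{i∈T} (y_i − ⟨x_i,β⟩)², and suppose the set S₂ = {i ∉ T : (y_i − ⟨x_i,β_T⟩)² < p_i} is nonempty. Then L(T ∪ S₂) < L(T). -/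
open scoped Classical

/-- Strict improvement by adding small-residual observations:
if `βT` minimizes `β ↦ ∑_{i∈T} (y i − ⟨x i, β⟩)²` and the set
`S₂ = {i ∉ T : (y i − ⟨x i, βT⟩)² < p i}` is nonempty, then `L(T ∪ S₂) < L(T)`. -/
theorem pts_strict_improvement_add
    (n p : ℕ) (hp : 1 ≤ p) (hpn : p ≤ n)
    (X : Matrix (Fin n) (Fin p) ℝ) (y : Fin n → ℝ)
    (pen : Fin n → ℝ) (hpen : ∀ i, 0 < pen i)
    (T : Finset (Fin n)) (βT : Fin p → ℝ)
    (hβT : ∀ β : Fin p → ℝ,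
      ∑ i ∈ T, (y i - ∑ j, X i j * βT j) ^ 2 ≤
      ∑ i ∈ T, (y i - ∑ j, X i j * β j) ^ 2)
    (S₂ : Finset (Fin n))
    (hS₂ : S₂ = Tᶜ.filter (fun i => (y i - ∑ j, X i j * βT j) ^ 2 < pen i))
    (hS₂ne : S₂.Nonempty) :
    sInf (Set.range fun b : Fin p → ℝ =>
        ∑ i ∈ T ∪ S₂, (y i - ∑ j, X i j * b j) ^ 2) + ∑ i ∈ (T ∪ S₂)ᶜ, pen i <
    sInf (Set.range fun b : Fin p → ℝ =>
        ∑ i ∈ T, (y i - ∑ j, X i j * b j) ^ 2) + ∑ i ∈ Tᶜ, pen i := by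
  have hdis : Disjoint T S₂ := by
    rw [Finset.disjoint_left]
    intro i hi h2
    rw [hS₂, Finset.mem_filter, Finset.mem_compl] at h2
    exact h2.1 hi
  have h1 : sInf (Set.range fun b : Fin p → ℝ =>
        ∑ i ∈ T ∪ S₂, (y i - ∑ j, X i j * b j) ^ 2) ≤
        ∑ i ∈ T ∪ S₂, (y i - ∑ j, X i j * βT j) ^ 2 := by
    refine csInf_le ⟨0, ?_⟩ ⟨βT, rfl⟩
    rintro _ ⟨b, rfl⟩
    exact Finset.sum_nonneg fun i _ => sq_nonneg _
  have h2 : ∑ i ∈ T, (y i - ∑ j, X i j * βT j) ^ 2 ≤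
      sInf (Set.range fun b : Fin p → ℝ =>
        ∑ i ∈ T, (y i - ∑ j, X i j * b j) ^ 2) := by
    refine le_csInf (Set.range_nonempty _) ?_
    rintro _ ⟨b, rfl⟩
    exact hβT b
  have h3 : ∑ i ∈ S₂, (y i - ∑ j, X i j * βT j) ^ 2 < ∑ i ∈ S₂, pen i := by
    refine Finset.sum_lt_sum_of_nonempty hS₂ne fun i hi => ?_
    rw [hS₂, Finset.mem_filter] at hi
    exact hi.2
  have h4 := Finset.sum_add_sum_compl (T ∪ S₂) pen
  have h5 := Finset.sum_add_sum_compl T pen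
  rw [Finset.sum_union hdis] at h1 h4
  linarith
end

section
/- Monotonicity of the PTS local search step: let T₁ ⊆ {1,…,n}, let β₁ minimize β ↦ Σ_{i∈T₁} (y_i − ⟨x_i,β⟩)², and define T₂ = {i ∈ {1,…,n} : (y_i − ⟨x_i,β₁⟩)² < p_i}. Then L(T₂) ≤ L(T₁). -/
open scoped Classical

/-- Monotonicity of the PTS local search step: if `β₁` minimizes
`β ↦ ∑_{i∈T₁} (y i − ⟨x i, β⟩)²` and `T₂ = {i : (y i − ⟨x i, β₁⟩)² < p i}`,
then `L(T₂) ≤ L(T₁)`. -/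
theorem pts_local_search_monotone
    (n p : ℕ) (hp : 1 ≤ p) (hpn : p ≤ n)
    (X : Matrix (Fin n) (Fin p) ℝ) (y : Fin n → ℝ)
    (pen : Fin n → ℝ) (hpen : ∀ i, 0 < pen i)
    (T₁ : Finset (Fin n)) (β₁ : Fin p → ℝ)
    (hβ₁ : ∀ β : Fin p → ℝ,
      ∑ i ∈ T₁, (y i - ∑ j, X i j * β₁ j) ^ 2 ≤
      ∑ i ∈ T₁, (y i - ∑ j, X i j * β j) ^ 2)
    (T₂ : Finset (Fin n))
    (hT₂ : T₂ = Finset.univ.filter (fun i => (y i - ∑ j, X i j * β₁ j) ^ 2 < pen i)) :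
    sInf (Set.range fun b : Fin p → ℝ =>
        ∑ i ∈ T₂, (y i - ∑ j, X i j * b j) ^ 2) + ∑ i ∈ T₂ᶜ, pen i ≤
    sInf (Set.range fun b : Fin p → ℝ =>
        ∑ i ∈ T₁, (y i - ∑ j, X i j * b j) ^ 2) + ∑ i ∈ T₁ᶜ, pen i := by

  have h1 : ∑ i ∈ T₁, (y i - ∑ j, X i j * β₁ j) ^ 2 ≤
      sInf (Set.range fun b : Fin p → ℝ => ∑ i ∈ T₁, (y i - ∑ j, X i j * b j) ^ 2) := by
    apply le_csInf (Set.range_nonempty _)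
    rintro _ ⟨b, rfl⟩
    exact hβ₁ b
  have h2 : sInf (Set.range fun b : Fin p → ℝ => ∑ i ∈ T₂, (y i - ∑ j, X i j * b j) ^ 2) ≤
      ∑ i ∈ T₂, (y i - ∑ j, X i j * β₁ j) ^ 2 := by
    apply csInf_le
    · refine ⟨0, ?_⟩
      rintro _ ⟨b, rfl⟩
      exact Finset.sum_nonneg fun i _ => sq_nonneg _
    · exact ⟨β₁, rfl⟩
  have key : ∀ T : Finset (Fin n),
      ∑ i ∈ T, (y i - ∑ j, X i j * β₁ j) ^ 2 + ∑ i ∈ Tᶜ, pen i =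
      ∑ i, if i ∈ T then (y i - ∑ j, X i j * β₁ j) ^ 2 else pen i := by
    intro T
    rw [← Finset.sum_add_sum_compl T]
    congr 1
    · exact Finset.sum_congr rfl fun i hi => (if_pos hi).symm
    · exact Finset.sum_congr rfl fun i hi => (if_neg (Finset.mem_compl.mp hi)).symm
  have h3 : ∑ i ∈ T₂, (y i - ∑ j, X i j * β₁ j) ^ 2 + ∑ i ∈ T₂ᶜ, pen i ≤
      ∑ i ∈ T₁, (y i - ∑ j, X i j * β₁ j) ^ 2 + ∑ i ∈ T₁ᶜ, pen i := by
    rw [key, key]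
    apply Finset.sum_le_sum
    intro i _
    have hm : i ∈ T₂ ↔ (y i - ∑ j, X i j * β₁ j) ^ 2 < pen i := by simp [hT₂]
    split_ifs with a b b
    · exact le_rfl
    · exact (hm.mp a).le
    · exact not_lt.mp fun h => a (hm.mpr h)
    · exact le_rfl
  linarith
end

section
/- The reduction in the sum of squared residuals due to the deletion of one observation equals the square of its adjusted residual: let X ∈ ℝ^{n×p} have full column rank, let β̂ = (XᵀX)⁻¹Xᵀy be the ordinary least squares estimate, let r_i = y_i − ⟨x_i, β̂⟩ and h_i = x_iᵀ(XᵀX)⁻¹x_i, and fix an index i such that h_i < 1 and the matrix X₋ᵢ obtained from X by deleting row i still has full column rank. Then min_{β∈ℝ^p} Σ_{j=1}^{n} (y_j − ⟨x_j,β⟩)² − min_{β∈ℝ^p} Σ_{j≠i} (y_j − ⟨x_j,β⟩)² = r_i² / (1 − h_i). -/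
open Matrix

theorem ols_sInf_aux {n p : ℕ} (X : Matrix (Fin n) (Fin p) ℝ) (y : Fin n → ℝ)
    (s : Finset (Fin n)) (b : Fin p → ℝ)
    (hb : ∀ k, ∑ j ∈ s, (y j - ∑ k, X j k * b k) * X j k = 0) :
    sInf (Set.range fun β : Fin p → ℝ => ∑ j ∈ s, (y j - ∑ k, X j k * β k) ^ 2) =
      ∑ j ∈ s, (y j - ∑ k, X j k * b k) ^ 2 := by
  apply IsLeast.csInf_eq
  refine ⟨⟨b, rfl⟩, ?_⟩
  rintro _ ⟨β, rfl⟩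
  have h0 : ∑ j ∈ s, (y j - ∑ k, X j k * b k) * (∑ k, X j k * (β k - b k)) = 0 := by
    simp_rw [Finset.mul_sum]
    rw [Finset.sum_comm]
    apply Finset.sum_eq_zero
    intro k _
    simp_rw [← mul_assoc]
    rw [← Finset.sum_mul, hb k, zero_mul]
  have h1 : ∑ j ∈ s, (y j - ∑ k, X j k * β k) ^ 2 = ∑ j ∈ s, (y j - ∑ k, X j k * b k) ^ 2
      - 2 * ∑ j ∈ s, (y j - ∑ k, X j k * b k) * (∑ k, X j k * (β k - b k))
      + ∑ j ∈ s, (∑ k, X j k * (β k - b k)) ^ 2 := by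
    rw [Finset.mul_sum, ← Finset.sum_sub_distrib, ← Finset.sum_add_distrib]
    apply Finset.sum_congr rfl
    intro j _
    simp_rw [mul_sub, Finset.sum_sub_distrib]
    ring
  have h2 : 0 ≤ ∑ j ∈ s, (∑ k, X j k * (β k - b k)) ^ 2 :=
    Finset.sum_nonneg fun j _ => sq_nonneg _
  simp only
  rw [h1, h0]
  linarith

/-- The reduction in the sum of squared residuals due to the
deletion of observation `i` equals the square of its adjusted residual:
`min_β ∑_j r(β)_j² − min_β ∑_{j≠i} r(β)_j² = r_i² / (1 − h_i)`, where `r_i` is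
the OLS residual and `h_i` the leverage of observation `i`. -/
theorem ols_deletion_reduction_eq_adjusted_residual_sq
    (n p : ℕ) (hp : 1 ≤ p) (hpn : p < n)
    (X : Matrix (Fin n) (Fin p) ℝ) (y : Fin n → ℝ)
    (hrank : X.rank = p)
    (βhat : Fin p → ℝ) (hβhat : βhat = (Xᵀ * X)⁻¹ *ᵥ (Xᵀ *ᵥ y))
    (i : Fin n) (r h : ℝ)
    (hr : r = y i - ∑ k, X i k * βhat k)
    (hh : h = X i ⬝ᵥ ((Xᵀ * X)⁻¹ *ᵥ X i))
    (hh1 : h < 1)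
    (hrank' : (X.submatrix (fun j : {j : Fin n // j ≠ i} => (j : Fin n)) id).rank = p) :
    sInf (Set.range fun β : Fin p → ℝ =>
        ∑ j, (y j - ∑ k, X j k * β k) ^ 2) -
    sInf (Set.range fun β : Fin p → ℝ =>
        ∑ j ∈ ({i}ᶜ : Finset (Fin n)), (y j - ∑ k, X j k * β k) ^ 2) =
    r ^ 2 / (1 - h) := by
  have hU : IsUnit (Xᵀ * X) := by
    have h1 : (Xᵀ * X).rank = p := by rw [Matrix.rank_transpose_mul_self, hrank]
    rw [← Matrix.mulVec_surjective_iff_isUnit]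
    have h2 : LinearMap.range (Xᵀ * X).mulVecLin = ⊤ := by
      apply Submodule.eq_top_of_finrank_eq
      rw [Matrix.rank] at h1
      rw [h1]; simp
    exact LinearMap.range_eq_top.1 h2
  have hdet : IsUnit (Xᵀ * X).det := (Matrix.isUnit_iff_isUnit_det _).1 hU
  set v : Fin p → ℝ := (Xᵀ * X)⁻¹ *ᵥ X i with hv
  have hGv : Xᵀ *ᵥ (X *ᵥ v) = X i := by
    rw [hv, Matrix.mulVec_mulVec, Matrix.mulVec_mulVec, Matrix.mul_nonsing_inv _ hdet,
      Matrix.one_mulVec]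
  have hGb : Xᵀ *ᵥ (X *ᵥ βhat) = Xᵀ *ᵥ y := by
    rw [hβhat, Matrix.mulVec_mulVec, Matrix.mulVec_mulVec, Matrix.mul_nonsing_inv _ hdet,
      Matrix.one_mulVec]
  have e1 : ∀ k, ∑ j, (∑ l, X j l * v l) * X j k = X i k := fun k => by
    have := congrFun hGv k
    simp only [Matrix.mulVec, dotProduct, Matrix.transpose_apply] at this
    rw [← this]
    exact Finset.sum_congr rfl fun j _ => mul_comm _ _
  have e2 : ∀ k, ∑ j, (y j - ∑ l, X j l * βhat l) * X j k = 0 := fun k => by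
    have := congrFun hGb k
    simp only [Matrix.mulVec, dotProduct, Matrix.transpose_apply] at this
    simp_rw [sub_mul, Finset.sum_sub_distrib]
    rw [sub_eq_zero]
    simp_rw [mul_comm _ (X _ k)]
    exact this.symm
  have hh' : ∑ k, X i k * v k = h := hh.symm
  have key : ∀ (f : Fin n → ℝ), ∑ j, f j * (∑ l, X j l * v l) = ∑ l, (∑ j, f j * X j l) * v l := by
    intro f
    simp_rw [Finset.mul_sum, Finset.sum_mul]
    rw [Finset.sum_comm]
    simp_rw [mul_assoc]
  have e3 : ∑ j, (∑ l, X j l * v l) * (∑ l, X j l * v l) = h := by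
    rw [key]; simp_rw [e1]; exact hh'
  have e4 : ∑ j, (y j - ∑ l, X j l * βhat l) * (∑ l, X j l * v l) = 0 := by
    rw [key]; simp_rw [e2]; simp
  have h1 : (1 - h) ≠ 0 := by linarith
  obtain ⟨c, hc⟩ : ∃ c, c = - r / (1 - h) := ⟨_, rfl⟩
  have hrc : r = - c * (1 - h) := by rw [hc]; field_simp
  have hlin : ∀ j, y j - ∑ k, X j k * (βhat k + c * v k)
      = (y j - ∑ k, X j k * βhat k) - c * ∑ k, X j k * v k := by
    intro j
    simp_rw [mul_add, Finset.sum_add_distrib, Finset.mul_sum, mul_left_comm c]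
    ring
  have hcompl : ∀ f : Fin n → ℝ, ∑ j ∈ ({i}ᶜ : Finset (Fin n)), f j = ∑ j, f j - f i := by
    intro f
    rw [← Finset.sum_compl_add_sum {i} f]; simp
  rw [ols_sInf_aux X y Finset.univ βhat e2,
    ols_sInf_aux X y {i}ᶜ (fun k => βhat k + c * v k) ?_]
  · simp_rw [hlin]
    rw [hcompl, ← hr, hh']
    have : ∑ j, ((y j - ∑ k, X j k * βhat k) - c * ∑ k, X j k * v k) ^ 2
        = ∑ j, (y j - ∑ k, X j k * βhat k) ^ 2
          - 2 * c * ∑ j, (y j - ∑ l, X j l * βhat l) * (∑ l, X j l * v l)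
          + c ^ 2 * ∑ j, (∑ l, X j l * v l) * (∑ l, X j l * v l) := by
      rw [Finset.mul_sum, Finset.mul_sum, ← Finset.sum_sub_distrib, ← Finset.sum_add_distrib]
      exact Finset.sum_congr rfl fun j _ => by ring
    rw [this, e3, e4, hrc]
    field_simp
    ring
  · intro k
    simp_rw [hlin]
    rw [hcompl, ← hr, hh']
    simp_rw [sub_mul, mul_assoc c, Finset.sum_sub_distrib, ← Finset.mul_sum, e1]
    have := e2 k
    simp_rw [sub_mul, Finset.sum_sub_distrib] at this
    rw [this, hrc]
    ring
end
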